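/- Suppose M₁₁ ≥ 0 and −M₂₂ ≥ 0, let k ∈ H, and suppose the family {u_ε}_{ε>0} with u_ε := −M_ε⁻¹k is bounded in H, i.e., sup_{ε>0} ‖u_ε‖ < ∞. Then there exists u* ∈ H with Mu* + k = 0 (equivalently, the quadratic functional J(u) = ⟨Mu,u⟩ + 2⟨k,u⟩ + c has a saddle point for any c ∈ ℝ). -/

import Mathlib

open scoped RealInnerProductSpace

/-- The block operator `(u₁, u₂) ↦ (M₁₁u₁ + M₁₂u₂, M₂₁u₁ + M₂₂u₂)` on the product
Hilbert space `H₁ ×₂ H₂` (with the `L²` product norm). -/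
noncomputable def blockOp {H₁ H₂ : Type*}
    [NormedAddCommGroup H₁] [InnerProductSpace ℝ H₁]
    [NormedAddCommGroup H₂] [InnerProductSpace ℝ H₂]
    (M11 : H₁ →L[ℝ] H₁) (M12 : H₂ →L[ℝ] H₁)
    (M21 : H₁ →L[ℝ] H₂) (M22 : H₂ →L[ℝ] H₂) :
    WithLp 2 (H₁ × H₂) →L[ℝ] WithLp 2 (H₁ × H₂) :=
  ((WithLp.prodContinuousLinearEquiv 2 ℝ H₁ H₂).symm.toContinuousLinearMap) ∘L
    ((M11 ∘L ContinuousLinearMap.fst ℝ H₁ H₂ + M12 ∘L ContinuousLinearMap.snd ℝ H₁ H₂).prod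
      (M21 ∘L ContinuousLinearMap.fst ℝ H₁ H₂ + M22 ∘L ContinuousLinearMap.snd ℝ H₁ H₂)) ∘L
    ((WithLp.prodContinuousLinearEquiv 2 ℝ H₁ H₂).toContinuousLinearMap)

/-- The element of the product Hilbert space `H₁ ×₂ H₂` with components `a` and `b`. -/
noncomputable def pairL2 {H₁ H₂ : Type*}
    [NormedAddCommGroup H₁] [InnerProductSpace ℝ H₁]
    [NormedAddCommGroup H₂] [InnerProductSpace ℝ H₂]
    (a : H₁) (b : H₂) : WithLp 2 (H₁ × H₂) :=
  (WithLp.equiv 2 (H₁ × H₂)).symm (a, b)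

/-- The quadratic functional `J(u) = ⟨Mu,u⟩ + 2⟨k,u⟩ + c` on the product Hilbert space. -/
noncomputable def quadJ {H₁ H₂ : Type*}
    [NormedAddCommGroup H₁] [InnerProductSpace ℝ H₁]
    [NormedAddCommGroup H₂] [InnerProductSpace ℝ H₂]
    (M11 : H₁ →L[ℝ] H₁) (M12 : H₂ →L[ℝ] H₁)
    (M21 : H₁ →L[ℝ] H₂) (M22 : H₂ →L[ℝ] H₂)
    (k : WithLp 2 (H₁ × H₂)) (c : ℝ) (u : WithLp 2 (H₁ × H₂)) : ℝ :=
  ⟪blockOp M11 M12 M21 M22 u, u⟫ + 2 * ⟪k, u⟫ + c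

/-- `(a, b)` is a saddle point of `J : H₁ ×₂ H₂ → ℝ`:
`J(a, u₂) ≤ J(a, b) ≤ J(u₁, b)` for all `u₁ ∈ H₁`, `u₂ ∈ H₂`. -/
def IsSaddlePoint {H₁ H₂ : Type*}
    [NormedAddCommGroup H₁] [InnerProductSpace ℝ H₁]
    [NormedAddCommGroup H₂] [InnerProductSpace ℝ H₂]
    (J : WithLp 2 (H₁ × H₂) → ℝ) (a : H₁) (b : H₂) : Prop :=
  (∀ u₂ : H₂, J (pairL2 a u₂) ≤ J (pairL2 a b)) ∧
    (∀ u₁ : H₁, J (pairL2 a b) ≤ J (pairL2 u₁ b))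

open Filter Topology

section ResolventFamily

variable {E : Type*} [NormedAddCommGroup E] [InnerProductSpace ℝ E]

/-- Two solutions of the regularised equation `A u + ε u + f = 0` for a monotone operator `A`
are at distance controlled by the gap between their squared norms. -/
theorem norm_sub_sq_le_of_monotone {A : E →L[ℝ] E} (hA : ∀ x, 0 ≤ ⟪A x, x⟫) {f u v : E}
    {ε δ : ℝ} (hε : 0 < ε) (hεδ : ε ≤ δ) (hu : A u + ε • u + f = 0)
    (hv : A v + δ • v + f = 0) : ‖u - v‖ ^ 2 ≤ ((δ - ε) / (ε + δ)) * (‖u‖ ^ 2 - ‖v‖ ^ 2) := by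
  have hAuv : A (u - v) = δ • v - ε • u := by
    rw [map_sub, ← sub_eq_zero]
    calc A u - A v - (δ • v - ε • u)
        = (A u + ε • u + f) - (A v + δ • v + f) := by module
      _ = 0 := by simp [hu, hv]
  have h := hA (u - v)
  rw [hAuv, inner_sub_left, inner_sub_right, inner_sub_right, real_inner_smul_left,
    real_inner_smul_left, real_inner_smul_left, real_inner_smul_left,
    real_inner_self_eq_norm_sq, real_inner_self_eq_norm_sq, real_inner_comm u v] at h
  rw [norm_sub_sq_real, div_mul_eq_mul_div, le_div_iff₀ (by linarith)]
  linarith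

/-- If the regularised solutions `u ε` of `A u + ε u + f = 0` stay bounded, the limit equation
`A u + f = 0` is solvable. -/
theorem exists_solution_of_bounded_regularised [CompleteSpace E] {A : E →L[ℝ] E}
    (hA : ∀ x, 0 ≤ ⟪A x, x⟫) {f : E} {u : ℝ → E} {C : ℝ}
    (hu : ∀ ε, 0 < ε → A (u ε) + ε • u ε + f = 0) (hC : ∀ ε, 0 < ε → ‖u ε‖ ≤ C) :
    ∃ x, A x + f = 0 := by
  set e : ℕ → ℝ := fun n => 1 / ((n : ℝ) + 1) with he
  have hpos : ∀ n, 0 < e n := fun n => Nat.one_div_pos_of_nat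
  have hanti : ∀ {m n}, m ≤ n → e n ≤ e m := fun h => Nat.one_div_le_one_div h
  have hlim : Tendsto e atTop (𝓝 0) := tendsto_one_div_add_atTop_nhds_zero_nat
  have key : ∀ {m n}, m ≤ n →
      ‖u (e n) - u (e m)‖ ^ 2 ≤ ‖u (e n)‖ ^ 2 - ‖u (e m)‖ ^ 2 := by
    intro m n hmn
    have hd := norm_sub_sq_le_of_monotone hA (hpos n) (hanti hmn) (hu _ (hpos n)) (hu _ (hpos m))
    have hn := hpos n
    have hm := hpos m
    have hr0 : 0 ≤ (e m - e n) / (e n + e m) :=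
      div_nonneg (sub_nonneg.2 (hanti hmn)) (by linarith)
    have hr1 : (e m - e n) / (e n + e m) ≤ 1 := (div_le_one (by linarith)).2 (by linarith)
    have hs := sq_nonneg ‖u (e n) - u (e m)‖
    rcases le_total 0 (‖u (e n)‖ ^ 2 - ‖u (e m)‖ ^ 2) with hg | hg
    · exact hd.trans (mul_le_of_le_one_left hg hr1)
    · have hz : u (e n) - u (e m) = 0 := by
        have := mul_nonpos_of_nonneg_of_nonpos hr0 hg
        simpa using le_antisymm (hd.trans this) hs
      simp [sub_eq_zero.1 hz]
  have hmono : Monotone fun n => ‖u (e n)‖ ^ 2 := fun m n hmn =>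
    sub_nonneg.1 ((sq_nonneg _).trans (key hmn))
  have hbdd : BddAbove (Set.range fun n => ‖u (e n)‖ ^ 2) := by
    refine ⟨C ^ 2, ?_⟩
    rintro _ ⟨n, rfl⟩
    exact pow_le_pow_left₀ (norm_nonneg _) (hC _ (hpos n)) 2
  have hcn := (tendsto_atTop_ciSup hmono hbdd).cauchySeq
  have hcau : CauchySeq fun n => u (e n) := by
    rw [Metric.cauchySeq_iff'] at hcn ⊢
    intro r hr
    obtain ⟨N, hN⟩ := hcn (r ^ 2) (by positivity)
    refine ⟨N, fun n hn => ?_⟩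
    have h := hN n hn
    rw [Real.dist_eq] at h
    rw [dist_eq_norm]
    exact lt_of_pow_lt_pow_left₀ 2 hr.le ((key hn).trans_lt ((le_abs_self _).trans_lt h))
  obtain ⟨x, hx⟩ := cauchySeq_tendsto_of_complete hcau
  refine ⟨x, ?_⟩
  have ht : Tendsto (fun n => A (u (e n)) + e n • u (e n) + f) atTop
      (𝓝 (A x + (0 : ℝ) • x + f)) :=
    ((((A.continuous.tendsto x).comp hx).add (hlim.smul hx))).add_const f
  have hconst : (fun n => A (u (e n)) + e n • u (e n) + f) = fun _ => 0 :=
    funext fun n => hu _ (hpos n)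
  rw [hconst] at ht
  simpa using (tendsto_nhds_unique ht tendsto_const_nhds)

end ResolventFamily

section BlockOp

theorem withLp_prod_ext {α β : Type*} {u v : WithLp 2 (α × β)} (h₁ : u.fst = v.fst)
    (h₂ : u.snd = v.snd) : u = v :=
  WithLp.ofLp_injective 2 (Prod.ext h₁ h₂)

theorem withLp_prod_inner_eq {F G : Type*} [NormedAddCommGroup F] [InnerProductSpace ℝ F]
    [NormedAddCommGroup G] [InnerProductSpace ℝ G] (u v : WithLp 2 (F × G)) :
    ⟪u, v⟫ = ⟪u.fst, v.fst⟫ + ⟪u.snd, v.snd⟫ := rfl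

variable {H₁ H₂ : Type*} [NormedAddCommGroup H₁] [InnerProductSpace ℝ H₁]
  [NormedAddCommGroup H₂] [InnerProductSpace ℝ H₂]
  (M11 : H₁ →L[ℝ] H₁) (M12 : H₂ →L[ℝ] H₁) (M21 : H₁ →L[ℝ] H₂) (M22 : H₂ →L[ℝ] H₂)

@[simp]
theorem blockOp_fst (u : WithLp 2 (H₁ × H₂)) :
    (blockOp M11 M12 M21 M22 u).fst = M11 u.fst + M12 u.snd := rfl

@[simp]
theorem blockOp_snd (u : WithLp 2 (H₁ × H₂)) :
    (blockOp M11 M12 M21 M22 u).snd = M21 u.fst + M22 u.snd := rfl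

@[simp]
theorem pairL2_fst (a : H₁) (b : H₂) : (pairL2 a b).fst = a := rfl

@[simp]
theorem pairL2_snd (a : H₁) (b : H₂) : (pairL2 a b).snd = b := rfl

/-- The reflection `(u₁, u₂) ↦ (u₁, -u₂)`. -/
noncomputable def reflectSnd (H₁ H₂ : Type*) [NormedAddCommGroup H₁] [InnerProductSpace ℝ H₁]
    [NormedAddCommGroup H₂] [InnerProductSpace ℝ H₂] :
    WithLp 2 (H₁ × H₂) →L[ℝ] WithLp 2 (H₁ × H₂) :=
  blockOp (ContinuousLinearMap.id ℝ H₁) 0 0 (-ContinuousLinearMap.id ℝ H₂)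

@[simp]
theorem reflectSnd_fst (u : WithLp 2 (H₁ × H₂)) : (reflectSnd H₁ H₂ u).fst = u.fst := by
  simp [reflectSnd]

@[simp]
theorem reflectSnd_snd (u : WithLp 2 (H₁ × H₂)) : (reflectSnd H₁ H₂ u).snd = -u.snd := by
  simp [reflectSnd]

theorem reflectSnd_mul_self : reflectSnd H₁ H₂ * reflectSnd H₁ H₂ = 1 := by
  ext u : 1
  exact withLp_prod_ext (by simp) (by simp)

theorem reflectSnd_blockOp_perturbed (ε : ℝ) :
    reflectSnd H₁ H₂ * blockOp (M11 + ε • ContinuousLinearMap.id ℝ H₁) M12 M21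
        (M22 - ε • ContinuousLinearMap.id ℝ H₂) =
      reflectSnd H₁ H₂ * blockOp M11 M12 M21 M22 + ε • 1 := by
  ext u : 1
  refine withLp_prod_ext ?_ ?_
  · simp; abel
  · simp; abel

variable {M11 M12 M21 M22} [CompleteSpace H₁] [CompleteSpace H₂]

theorem inner_reflectSnd_blockOp_nonneg (h21 : M21 = ContinuousLinearMap.adjoint M12)
    (h11pos : ∀ u₁ : H₁, 0 ≤ ⟪M11 u₁, u₁⟫) (h22neg : ∀ u₂ : H₂, 0 ≤ ⟪(-M22) u₂, u₂⟫)
    (u : WithLp 2 (H₁ × H₂)) :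
    0 ≤ ⟪(reflectSnd H₁ H₂ * blockOp M11 M12 M21 M22) u, u⟫ := by
  have h₁ := h11pos u.fst
  have h₂ := h22neg u.snd
  have hc : ⟪M21 u.fst, u.snd⟫ = ⟪M12 u.snd, u.fst⟫ := by
    rw [h21, ContinuousLinearMap.adjoint_inner_left, real_inner_comm]
  rw [neg_apply, inner_neg_left] at h₂
  simp only [withLp_prod_inner_eq, mul_apply_eq_comp, reflectSnd_fst,
    reflectSnd_snd, blockOp_fst, blockOp_snd, inner_add_left, inner_neg_left]
  linarith

/-- Completing the square: at a critical point the increment of `quadJ` is the quadratic part. -/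
theorem quadJ_eq_add_of_critical (h21 : M21 = ContinuousLinearMap.adjoint M12)
    (h11sa : IsSelfAdjoint M11) (h22sa : IsSelfAdjoint M22) {k u : WithLp 2 (H₁ × H₂)}
    (hu : blockOp M11 M12 M21 M22 u + k = 0) (c : ℝ) (v : WithLp 2 (H₁ × H₂)) :
    quadJ M11 M12 M21 M22 k c v =
      quadJ M11 M12 M21 M22 k c u + ⟪blockOp M11 M12 M21 M22 (v - u), v - u⟫ := by
  have hsymm : ⟪blockOp M11 M12 M21 M22 v, u⟫ = ⟪blockOp M11 M12 M21 M22 u, v⟫ := by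
    have e1 : ⟪M11 v.fst, u.fst⟫ = ⟪M11 u.fst, v.fst⟫ := by
      rw [← ContinuousLinearMap.adjoint_inner_right, h11sa.adjoint_eq, real_inner_comm]
    have e2 : ⟪M22 v.snd, u.snd⟫ = ⟪M22 u.snd, v.snd⟫ := by
      rw [← ContinuousLinearMap.adjoint_inner_right, h22sa.adjoint_eq, real_inner_comm]
    have e3 : ∀ a b, ⟪M21 a, b⟫ = ⟪M12 b, a⟫ := fun a b => by
      rw [h21, ContinuousLinearMap.adjoint_inner_left, real_inner_comm]
    simp only [withLp_prod_inner_eq, blockOp_fst, blockOp_snd, inner_add_left, e1, e2, e3]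
    ring
  rw [eq_neg_of_add_eq_zero_right hu]
  simp only [quadJ, map_sub, inner_sub_left, inner_sub_right, inner_neg_left, hsymm]
  ring

theorem isSaddlePoint_quadJ_of_critical (h21 : M21 = ContinuousLinearMap.adjoint M12)
    (h11sa : IsSelfAdjoint M11) (h22sa : IsSelfAdjoint M22)
    (h11pos : ∀ u₁ : H₁, 0 ≤ ⟪M11 u₁, u₁⟫) (h22neg : ∀ u₂ : H₂, 0 ≤ ⟪(-M22) u₂, u₂⟫)
    {k : WithLp 2 (H₁ × H₂)} {a : H₁} {b : H₂}
    (hab : blockOp M11 M12 M21 M22 (pairL2 a b) + k = 0) (c : ℝ) :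
    IsSaddlePoint (quadJ M11 M12 M21 M22 k c) a b := by
  refine ⟨fun u₂ => ?_, fun u₁ => ?_⟩
  · have h := h22neg (u₂ - b)
    rw [neg_apply, inner_neg_left] at h
    rw [quadJ_eq_add_of_critical h21 h11sa h22sa hab c (pairL2 a u₂)]
    simp only [withLp_prod_inner_eq, blockOp_fst, blockOp_snd, WithLp.sub_fst,
      WithLp.sub_snd, pairL2_fst, pairL2_snd, sub_self, map_zero, inner_zero_right, zero_add]
    linarith
  · have h := h11pos (u₁ - a)
    rw [quadJ_eq_add_of_critical h21 h11sa h22sa hab c (pairL2 u₁ b)]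
    simp only [withLp_prod_inner_eq, blockOp_fst, blockOp_snd, WithLp.sub_fst,
      WithLp.sub_snd, pairL2_fst, pairL2_snd, sub_self, map_zero, inner_zero_right, add_zero]
    linarith

end BlockOp

/-- If `M₁₁ ≥ 0`, `−M₂₂ ≥ 0`, and the family `u_ε = −M_ε⁻¹k` (ε > 0) is bounded, then
there exists `u*` with `Mu* + k = 0`; equivalently, the quadratic functional
`J(u) = ⟨Mu,u⟩ + 2⟨k,u⟩ + c` has a saddle point for any `c`. -/
theorem exists_saddle_of_bounded_perturbed_family {H₁ H₂ : Type*}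
    [NormedAddCommGroup H₁] [InnerProductSpace ℝ H₁] [CompleteSpace H₁]
    [NormedAddCommGroup H₂] [InnerProductSpace ℝ H₂] [CompleteSpace H₂]
    (M11 : H₁ →L[ℝ] H₁) (M12 : H₂ →L[ℝ] H₁)
    (M21 : H₁ →L[ℝ] H₂) (M22 : H₂ →L[ℝ] H₂)
    (h21 : M21 = ContinuousLinearMap.adjoint M12)
    (h11sa : IsSelfAdjoint M11) (h22sa : IsSelfAdjoint M22)
    (h11pos : ∀ u₁ : H₁, 0 ≤ ⟪M11 u₁, u₁⟫)
    (h22neg : ∀ u₂ : H₂, 0 ≤ ⟪(-M22) u₂, u₂⟫)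
    (k : WithLp 2 (H₁ × H₂))
    (hbdd : ∃ Cb : ℝ, ∀ ε : ℝ, 0 < ε →
      ∀ S : WithLp 2 (H₁ × H₂) →L[ℝ] WithLp 2 (H₁ × H₂),
        S ∘L blockOp (M11 + ε • ContinuousLinearMap.id ℝ H₁) M12 M21
            (M22 - ε • ContinuousLinearMap.id ℝ H₂) = ContinuousLinearMap.id ℝ _ →
        blockOp (M11 + ε • ContinuousLinearMap.id ℝ H₁) M12 M21
            (M22 - ε • ContinuousLinearMap.id ℝ H₂) ∘L S = ContinuousLinearMap.id ℝ _ →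
        ‖-(S k)‖ ≤ Cb) :
    ∃ (u₁s : H₁) (u₂s : H₂),
      blockOp M11 M12 M21 M22 (pairL2 u₁s u₂s) + k = 0 ∧
      ∀ c : ℝ, IsSaddlePoint (quadJ M11 M12 M21 M22 k c) u₁s u₂s := by
  obtain ⟨C, hC⟩ := hbdd
  set R := reflectSnd H₁ H₂ with hR
  set M := blockOp M11 M12 M21 M22 with hM
  have hRR : R * R = 1 := reflectSnd_mul_self
  have hA : ∀ x, 0 ≤ ⟪(R * M) x, x⟫ := inner_reflectSnd_blockOp_nonneg h21 h11pos h22neg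
  have hreg : ∀ ε : ℝ, ∃ u, 0 < ε → ((R * M) u + ε • u + R k = 0 ∧ ‖u‖ ≤ C) := by
    intro ε
    by_cases hε : 0 < ε
    swap
    · exact ⟨0, fun h => absurd h hε⟩
    set Mε := blockOp (M11 + ε • ContinuousLinearMap.id ℝ H₁) M12 M21
      (M22 - ε • ContinuousLinearMap.id ℝ H₂) with hMε
    have hRM : R * Mε = R * M + ε • 1 := reflectSnd_blockOp_perturbed M11 M12 M21 M22 ε
    have hunit : IsUnit (R * Mε) := by
      refine ContinuousLinearMap.isUnit_of_forall_le_norm_inner_map _ (c := ⟨ε, hε.le⟩) hε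
        fun x => ?_
      have h : ⟪(R * Mε) x, x⟫ = ⟪(R * M) x, x⟫ + ε * ‖x‖ ^ 2 := by
        rw [hRM, add_apply, inner_add_left, smul_apply,
          one_apply_eq_self, real_inner_smul_left, real_inner_self_eq_norm_sq]
      rw [h, Real.norm_eq_abs]
      refine le_trans ?_ (le_abs_self _)
      have := hA x
      change ‖x‖ ^ 2 * ε ≤ _
      linarith
    have hMunit : IsUnit Mε := by
      have h : R * (R * Mε) = Mε := by rw [← mul_assoc, hRR, one_mul]
      rw [← h]
      exact IsUnit.mul ⟨⟨R, R, hRR, hRR⟩, rfl⟩ hunit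
    obtain ⟨U, hU⟩ := hMunit
    have hl : ↑U⁻¹ * Mε = 1 := by rw [← hU, Units.inv_mul]
    have hr : Mε * ↑U⁻¹ = 1 := by rw [← hU, Units.mul_inv]
    refine ⟨-((↑U⁻¹ : WithLp 2 (H₁ × H₂) →L[ℝ] WithLp 2 (H₁ × H₂)) k), fun _ =>
      ⟨?_, hC ε hε _ hl hr⟩⟩
    have hk := DFunLike.congr_fun hr k
    have happ := DFunLike.congr_fun hRM (-((↑U⁻¹ : WithLp 2 (H₁ × H₂) →L[ℝ] _) k))
    have hRk : (R * Mε) (-((↑U⁻¹ : WithLp 2 (H₁ × H₂) →L[ℝ] _) k)) = -R k := by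
      rw [map_neg, mul_apply_eq_comp]
      exact congrArg (fun x => -R x) hk
    rw [hRk] at happ
    exact (congrArg (· + R k) happ).symm.trans (neg_add_cancel _)
  choose u hu using hreg
  obtain ⟨x, hx⟩ := exists_solution_of_bounded_regularised hA (fun ε hε => (hu ε hε).1)
    (fun ε hε => (hu ε hε).2)
  have hcrit : M (pairL2 x.fst x.snd) + k = 0 := by
    have h : R (R (M x + k)) = 0 := by
      rw [map_add R (M x) k]
      exact (congrArg R hx).trans (map_zero R)
    exact (DFunLike.congr_fun hRR (M x + k)).symm.trans h
  exact ⟨x.fst, x.snd, hcrit,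
    isSaddlePoint_quadJ_of_critical h21 h11sa h22sa h11pos h22neg hcrit⟩
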